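/- Let P(z) = ∑_{n=0}^{N} B_n z^n be an m×m polynomial matrix with complex coefficients, and let a ∈ ℂ be a simple root of the scalar polynomial det P (i.e., det P(a) = 0 and (det P)'(a) ≠ 0). Then the matrix P(a) ∈ ℂ^{m×m} has rank m − 1. -/

import Mathlib

theorem hasDerivAt_det_two_zero_rows {m : ℕ} (Q : ℂ → Matrix (Fin m) (Fin m) ℂ) (a : ℂ)
    (hQ : ∀ i j, DifferentiableAt ℂ (fun z => Q z i j) a) (r s : Fin m) (hrs : r ≠ s)
    (hr : ∀ j, Q a r j = 0) (hs : ∀ j, Q a s j = 0) :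
    HasDerivAt (fun z => (Q z).det) 0 a := by
  simp only [Matrix.det_apply']
  have key : ∀ σ : Equiv.Perm (Fin m), HasDerivAt
      (fun z => ((Equiv.Perm.sign σ : ℤ) : ℂ) * ∏ i, Q z (σ i) i) 0 a := by
    intro σ
    have h := (HasDerivAt.fun_finsetProd (u := Finset.univ)
      (f := fun i z => Q z (σ i) i) (x := a)
      (fun i _ => (hQ (σ i) i).hasDerivAt)).const_mul ((Equiv.Perm.sign σ : ℤ) : ℂ)
    refine h.congr_deriv ?_
    apply mul_eq_zero_of_right
    apply Finset.sum_eq_zero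
    intro i _
    by_cases hi : i = σ.symm r
    · have : ∏ j ∈ Finset.univ.erase i, Q a (σ j) j = 0 := by
        apply Finset.prod_eq_zero (i := σ.symm s)
        · simp [hi, hrs.symm]
        · simp [hs]
      simp [this]
    · have : ∏ j ∈ Finset.univ.erase i, Q a (σ j) j = 0 := by
        apply Finset.prod_eq_zero (i := σ.symm r)
        · simpa using fun h => hi h.symm
        · simp [hr]
      simp [this]
  simpa using HasDerivAt.fun_sum (u := Finset.univ) (fun σ _ => key σ)

open Finset in
/-- **Lemma 1.** If `P(z) = ∑_{n=0}^N B_n zⁿ` is an `m×m` polynomial matrix and `a ∈ ℂ`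
is a simple root of `det P` (i.e. `det P(a) = 0` and `(det P)'(a) ≠ 0`), then the matrix
`P(a)` has rank `m - 1`. -/
theorem rank_at_simple_root_of_det (m N : ℕ) (B : Fin (N + 1) → Matrix (Fin m) (Fin m) ℂ)
    (a : ℂ)
    (hroot : (∑ n : Fin (N + 1), a ^ (n : ℕ) • B n).det = 0)
    (hsimple : deriv (fun z : ℂ => (∑ n : Fin (N + 1), z ^ (n : ℕ) • B n).det) a ≠ 0) :
    (∑ n : Fin (N + 1), a ^ (n : ℕ) • B n).rank = m - 1 := by
  set P : ℂ → Matrix (Fin m) (Fin m) ℂ := fun z => ∑ n : Fin (N + 1), z ^ (n : ℕ) • B n with hP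
  change (P a).det = 0 at hroot
  change deriv (fun z => (P z).det) a ≠ 0 at hsimple
  change (P a).rank = m - 1
  have hPd : ∀ i j, DifferentiableAt ℂ (fun z => P z i j) a := by
    intro i j
    simp only [hP, Matrix.sum_apply, Matrix.smul_apply, smul_eq_mul]
    fun_prop
  obtain ⟨V, U, e, hV, hU, h⟩ := (P a).exists_rank_normal_form
  have hV' : V.det ≠ 0 := ((Matrix.isUnit_iff_isUnit_det _).1 hV).ne_zero
  have hU' : U.det ≠ 0 := ((Matrix.isUnit_iff_isUnit_det _).1 hU).ne_zero
  have hcard : Fintype.card (Fin m) = m := Fintype.card_fin m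
  have h0 : Fintype.card (Fin m) - (P a).rank ≠ 0 := by
    intro h0
    have hemp : IsEmpty (Fin (Fintype.card (Fin m) - (P a).rank)) := by
      rw [h0]; infer_instance
    have h1 : (Matrix.fromBlocks 1 0 0 0 : Matrix (Fin (P a).rank ⊕ Fin (Fintype.card (Fin m) - (P a).rank)) (Fin (P a).rank ⊕ Fin (Fintype.card (Fin m) - (P a).rank)) ℂ) = 1 := by
      rw [← Matrix.fromBlocks_one]
      congr 1
      ext i; exact hemp.elim i
    rw [h1] at h
    have := congrArg Matrix.det h
    simp [Matrix.det_mul, hroot] at this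
  have h2 : ¬ 2 ≤ Fintype.card (Fin m) - (P a).rank := by
    intro h2
    apply hsimple
    have hd := hasDerivAt_det_two_zero_rows (fun z => V * P z * U) a
      (by
        intro i j
        simp only [Matrix.mul_apply]
        fun_prop)
      (e.symm (Sum.inr ⟨0, by omega⟩)) (e.symm (Sum.inr ⟨1, by omega⟩))
      (by simp)
      (by
        intro j
        simp only [h, Matrix.submatrix_apply, Equiv.apply_symm_apply]
        cases e j <;> simp)
      (by
        intro j
        simp only [h, Matrix.submatrix_apply, Equiv.apply_symm_apply]
        cases e j <;> simp)
    have hd2 := (hd.const_mul (V.det * U.det)⁻¹).deriv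
    rw [mul_zero] at hd2
    rw [← hd2]
    congr 1
    ext z
    simp only [Matrix.det_mul]
    field_simp
  omega
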